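/- arXiv:2111.15407 — 3 statements merged into one kernel-verified Lean document; each statement's English description precedes it below -/
import Mathlib

section
/- Let T > 0 and let f : ℝ → ℝ be continuous. Then f is monotone on ℝ, i.e. (x − y)(f(x) − f(y)) ≥ 0 for all x, y ∈ ℝ, if and only if for all continuous functions u₁, u₂ : ℝ → ℝ one has ∫₀ᵀ (u₁(t) − u₂(t))(f(u₁(t)) − f(u₂(t))) dt ≥ 0. (A resistor is monotone on the space of T-periodic square-integrable signals if and only if its device law is monotone on ℝ.) -/
/-- A continuous device law `f` is monotone on ℝ iff the corresponding resistor
relation is monotone on the space of signals over `[0, T]`. -/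
theorem resistor_monotone_iff_device_law_monotone
    (T : ℝ) (hT : 0 < T) (f : ℝ → ℝ) (hf : Continuous f) :
    (∀ x y : ℝ, 0 ≤ (x - y) * (f x - f y)) ↔
    (∀ u₁ u₂ : ℝ → ℝ, Continuous u₁ → Continuous u₂ →
      0 ≤ ∫ t in (0:ℝ)..T, (u₁ t - u₂ t) * (f (u₁ t) - f (u₂ t))) := by
  constructor
  · intro h u₁ u₂ _ _
    exact intervalIntegral.integral_nonneg hT.le fun t _ => h (u₁ t) (u₂ t)
  · intro h x y
    have hxy := h (fun _ => x) (fun _ => y) continuous_const continuous_const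
    rw [intervalIntegral.integral_const, sub_zero, smul_eq_mul] at hxy
    exact nonneg_of_mul_nonneg_right hxy hT
end

section
/- Let T > 0, let c : ℝ → ℝ be T-periodic and continuously differentiable, and let v₁, v₂ : ℝ → ℝ be T-periodic and continuously differentiable. Define the currents i_j(t) = c(t) · (d/dt)(c(t) v_j(t)) for j = 1, 2. Then ∫₀ᵀ (v₁(t) − v₂(t))(i₁(t) − i₂(t)) dt = 0. In particular the varcapacitor relation v ↦ c · (c v)′ is monotone on T-periodic signals. -/
/-- The integral of `f * f'` vanishes over an interval at whose endpoints `f` takes equal values. -/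
theorem intervalIntegral_mul_deriv_self_eq_zero {f : ℝ → ℝ} (hf : ContDiff ℝ 1 f) {a b : ℝ}
    (hab : f a = f b) : ∫ t in a..b, f t * deriv f t = 0 := by
  have hderiv : ∀ t ∈ Set.uIcc a b, HasDerivAt (fun s => f s ^ 2 / 2) (f t * deriv f t) t := by
    intro t _
    have h := (((hf.differentiable one_ne_zero) t).hasDerivAt.pow 2).div_const 2
    exact h.congr_deriv (by norm_num; ring)
  have hcont : Continuous fun t => f t * deriv f t :=
    hf.continuous.mul (hf.continuous_deriv le_rfl)
  rw [intervalIntegral.integral_eq_sub_of_hasDerivAt hderiv (hcont.intervalIntegrable a b), hab,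
    sub_self]

/-- The varcapacitor relation `v ↦ c ⬝ (c v)'` with T-periodic `c` is monotone
(indeed incrementally lossless) on T-periodic signals. -/
theorem varcapacitor_monotone
    (T : ℝ) (hT : 0 < T)
    (c v₁ v₂ : ℝ → ℝ)
    (hc : ContDiff ℝ 1 c) (hcT : ∀ t, c (t + T) = c t)
    (hv₁ : ContDiff ℝ 1 v₁) (hv₁T : ∀ t, v₁ (t + T) = v₁ t)
    (hv₂ : ContDiff ℝ 1 v₂) (hv₂T : ∀ t, v₂ (t + T) = v₂ t)
    (i₁ i₂ : ℝ → ℝ)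
    (hi₁ : ∀ t, i₁ t = c t * deriv (fun s => c s * v₁ s) t)
    (hi₂ : ∀ t, i₂ t = c t * deriv (fun s => c s * v₂ s) t) :
    ∫ t in (0:ℝ)..T, (v₁ t - v₂ t) * (i₁ t - i₂ t) = 0 := by
  have hd₁ : Differentiable ℝ fun s => c s * v₁ s := (hc.mul hv₁).differentiable one_ne_zero
  have hd₂ : Differentiable ℝ fun s => c s * v₂ s := (hc.mul hv₂).differentiable one_ne_zero
  have hderiv : ∀ t, deriv (fun s => c s * v₁ s - c s * v₂ s) t =
      deriv (fun s => c s * v₁ s) t - deriv (fun s => c s * v₂ s) t :=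
    fun t => deriv_fun_sub (hd₁ t) (hd₂ t)
  have hT₀ : c 0 * v₁ 0 - c 0 * v₂ 0 = c T * v₁ T - c T * v₂ T := by
    rw [← hcT 0, ← hv₁T 0, ← hv₂T 0, zero_add]
  have hlossless := intervalIntegral_mul_deriv_self_eq_zero ((hc.mul hv₁).sub (hc.mul hv₂)) hT₀
  refine Eq.trans (intervalIntegral.integral_congr fun t _ => ?_) hlossless
  simp only [hi₁, hi₂, hderiv]
  ring
end

section
/- Let T > 0, let l : ℝ → ℝ be T-periodic and continuously differentiable, and let i₁, i₂ : ℝ → ℝ be T-periodic and continuously differentiable. Define the voltages v_j(t) = l(t) · (d/dt)(l(t) i_j(t)) for j = 1, 2. Then ∫₀ᵀ (v₁(t) − v₂(t))(i₁(t) − i₂(t)) dt = 0. In particular the varinductor relation i ↦ l · (l i)′ is monotone on T-periodic signals. -/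
/-- The varinductor relation `i ↦ l ⬝ (l i)'` with T-periodic `l` is monotone
(indeed incrementally lossless) on T-periodic signals. -/
theorem varinductor_monotone
    (T : ℝ) (hT : 0 < T)
    (l i₁ i₂ : ℝ → ℝ)
    (hl : ContDiff ℝ 1 l) (hlT : ∀ t, l (t + T) = l t)
    (hi₁ : ContDiff ℝ 1 i₁) (hi₁T : ∀ t, i₁ (t + T) = i₁ t)
    (hi₂ : ContDiff ℝ 1 i₂) (hi₂T : ∀ t, i₂ (t + T) = i₂ t)
    (v₁ v₂ : ℝ → ℝ)
    (hv₁ : ∀ t, v₁ t = l t * deriv (fun s => l s * i₁ s) t)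
    (hv₂ : ∀ t, v₂ t = l t * deriv (fun s => l s * i₂ s) t) :
    ∫ t in (0:ℝ)..T, (v₁ t - v₂ t) * (i₁ t - i₂ t) = 0 := by
  have hc₁ : ContDiff ℝ 1 (fun s => l s * i₁ s) := hl.mul hi₁
  have hc₂ : ContDiff ℝ 1 (fun s => l s * i₂ s) := hl.mul hi₂
  have hl0 : l T = l 0 := by simpa using hlT 0
  have hi₁0 : i₁ T = i₁ 0 := by simpa using hi₁T 0
  have hi₂0 : i₂ T = i₂ 0 := by simpa using hi₂T 0
  have hderiv : ∀ t, HasDerivAt (fun s => (l s * i₁ s - l s * i₂ s) ^ 2 / 2)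
      ((v₁ t - v₂ t) * (i₁ t - i₂ t)) t := by
    intro t
    have h₁ := (hc₁.differentiable one_ne_zero t).hasDerivAt
    have h₂ := (hc₂.differentiable one_ne_zero t).hasDerivAt
    refine (((h₁.sub h₂).pow 2).div_const 2).congr_deriv ?_
    rw [hv₁, hv₂]
    simp only [Pi.sub_apply]
    ring
  have hcont : Continuous (fun t => (v₁ t - v₂ t) * (i₁ t - i₂ t)) := by
    rw [funext hv₁, funext hv₂]
    exact ((hl.continuous.mul (hc₁.continuous_deriv le_rfl)).sub
      (hl.continuous.mul (hc₂.continuous_deriv le_rfl))).mul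
      (hi₁.continuous.sub hi₂.continuous)
  rw [intervalIntegral.integral_eq_sub_of_hasDerivAt (fun t _ => hderiv t)
    (hcont.intervalIntegrable 0 T), hl0, hi₁0, hi₂0, sub_self]
end
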